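/- arXiv:1402.6350 — 7 statements merged into one kernel-verified Lean document; each statement's English description precedes it below -/
import Mathlib

section
/- Log-determinant formula for sparse grid covariance matrices (Theorem 1): Assume every matrix S_{i,j} for 1 ≤ i ≤ d and 1 ≤ j ≤ η−d+1 is positive definite (hence Σ is positive definite). Then log det Σ = Σ_{j ∈ J(η)} Σ_{i=1}^d ( log det S_{i,j_i} − log det S_{i,j_i−1} ) · ∏_{k ≠ i} ( #X_{k,j_k} − #X_{k,j_k−1} ), with the conventions det S_{i,0} = 1 and #X_{i,0} = 0. -/
open Finset Matrix

noncomputable section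

/-- Multi-indices `j ∈ ℕ^d` with all entries at least 1 and `∑ j i = η`. -/
def idxE (d η : ℕ) : Finset (Fin d → ℕ) :=
  (Fintype.piFinset fun _ : Fin d => Finset.Icc 1 η).filter fun j => ∑ i, j i = η

/-- The index set `J(η)`: multi-indices with all entries at least 1 and `∑ j i ≤ η`. -/
def idxJ (d η : ℕ) : Finset (Fin d → ℕ) :=
  (Fintype.piFinset fun _ : Fin d => Finset.Icc 1 η).filter fun j => ∑ i, j i ≤ η

/-- The lattice design `X_{1,j_1} × ⋯ × X_{d,j_d}`. -/
def lattice {d : ℕ} (X : Fin d → ℕ → Finset ℝ) (j : Fin d → ℕ) : Finset (Fin d → ℝ) :=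
  Fintype.piFinset fun i => X i (j i)

/-- The sparse grid design `X_SG(η)`. -/
def sparseGrid {d : ℕ} (X : Fin d → ℕ → Finset ℝ) (η : ℕ) : Finset (Fin d → ℝ) :=
  (idxE d η).biUnion fun j => lattice X j

/-- The component covariance matrix `S_{i,j} = (C_i(x,x'))_{x,x' ∈ X_{i,j}}`. -/
def Smat {d : ℕ} (X : Fin d → ℕ → Finset ℝ) (C : Fin d → ℝ → ℝ → ℝ) (i : Fin d) (j : ℕ) :
    Matrix ↥(X i j) ↥(X i j) ℝ :=
  Matrix.of fun x y => C i x.1 y.1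

/-- The covariance matrix `Σ = (∏ i, C_i(x^{(i)}, y^{(i)}))_{x,y ∈ X_SG(η)}`. -/
def SigmaMat {d : ℕ} (X : Fin d → ℕ → Finset ℝ) (C : Fin d → ℝ → ℝ → ℝ) (η : ℕ) :
    Matrix ↥(sparseGrid X η) ↥(sparseGrid X η) ℝ :=
  Matrix.of fun x y => ∏ i, C i (x.1 i) (y.1 i)

/-- The `LDL` decomposition of a positive definite matrix over a finite linear order, entrywise. -/
theorem exists_ldl_apply {n : Type*} [Fintype n] [LinearOrder n] {S : Matrix n n ℝ}
    (hS : S.PosDef) :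
    ∃ (L : n → n → ℝ) (D : n → ℝ), (∀ x y, L x y ≠ 0 → y ≤ x) ∧
      ∀ x y, S x y = ∑ z, L x z * D z * L y z := by
  classical
  let : LocallyFiniteOrderBot n :=
    LocallyFiniteOrderBot.ofIic' n (fun a => Finset.univ.filter (· ≤ a)) (by simp)
  refine ⟨LDL.lower hS, LDL.diagEntries hS, fun x y hxy => ?_, fun x y => ?_⟩
  · have hinv : (LDL.lowerInv hS).BlockTriangular OrderDual.toDual :=
      fun i j hij => LDL.lowerInv_triangular hS hij
    by_contra! h
    exact hxy (blockTriangular_inv_of_blockTriangular hinv h)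
  · conv_lhs => rw [← LDL.lower_conj_diag hS]
    simp [LDL.diag, Matrix.mul_apply (M := _ * _), Matrix.mul_diagonal]

/-- A kernel that is positive definite on a finite set `T` has there an `LDL` decomposition that
is triangular with respect to any linear order. -/
theorem exists_ldl_finset {α β : Type*} [LinearOrder β] (f : α → β) (hf : Function.Injective f)
    (T : Finset α) (K : α → α → ℝ) (hK : (Matrix.of fun x y : T => K x y).PosDef) :
    ∃ (L : α → α → ℝ) (D : α → ℝ), (∀ x y, L x y ≠ 0 → f y ≤ f x) ∧
      ∀ x ∈ T, ∀ y ∈ T, K x y = ∑ z ∈ T, L x z * D z * L y z := by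
  classical
  let : LinearOrder T := LinearOrder.lift' (fun x : T => f x) (hf.comp Subtype.val_injective)
  obtain ⟨L, D, hL, hS⟩ := exists_ldl_apply hK
  refine ⟨fun x y => if h : x ∈ T ∧ y ∈ T then L ⟨x, h.1⟩ ⟨y, h.2⟩ else 0,
    fun x => if h : x ∈ T then D ⟨x, h⟩ else 0, fun x y hxy => ?_, fun x hx y hy => ?_⟩
  · by_cases h : x ∈ T ∧ y ∈ T
    · simp only [h, and_self, dite_true] at hxy
      exact hL _ _ hxy
    · simp [h] at hxy
  · have := hS ⟨x, hx⟩ ⟨y, hy⟩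
    simp only [Matrix.of_apply] at this
    rw [this, ← Finset.sum_coe_sort T]
    exact Finset.sum_congr rfl fun z _ => by simp [hx, hy]

/-- The determinant of a matrix that is lower triangular for some linear order of its index. -/
theorem det_eq_prod_diag_of_injective {n β : Type*} [Fintype n] [DecidableEq n] [LinearOrder β]
    (f : n → β) (hf : Function.Injective f) (M : Matrix n n ℝ)
    (hM : ∀ x y, M x y ≠ 0 → f y ≤ f x) : M.det = ∏ x, M x x := by
  let : LinearOrder n := LinearOrder.lift' f hf
  have h : M.IsLowerTriangular := fun x y hxy => by
    by_contra hne
    exact absurd hxy (not_lt.2 (show f y ≤ f x from hM x y hne))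
  convert Matrix.det_of_isLowerTriangular M h

/-- If `G` is closed under the support of the triangular factor `L`, then the determinant on `G`
of the kernel `L D Lᵀ` is the product over `G` of its pivots. -/
theorem det_ldl_finset {α β : Type*} [DecidableEq α] [LinearOrder β] (f : α → β)
    (hf : Function.Injective f) {T G : Finset α} (hGT : G ⊆ T) {K L : α → α → ℝ} {D : α → ℝ}
    (hL : ∀ x y, L x y ≠ 0 → f y ≤ f x)
    (hK : ∀ x ∈ T, ∀ y ∈ T, K x y = ∑ z ∈ T, L x z * D z * L y z)
    (hG : ∀ x ∈ G, ∀ y ∈ T, L x y ≠ 0 → y ∈ G) :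
    (Matrix.of fun x y : G => K x y).det = ∏ x ∈ G, L x x ^ 2 * D x := by
  have h : (Matrix.of fun x y : G => K x y) = (Matrix.of fun x y : G => L x y) *
      Matrix.diagonal (fun x : G => D x) * (Matrix.of fun x y : G => L x y)ᵀ := by
    ext x y
    simp only [Matrix.of_apply, Matrix.mul_apply (M := _ * _), Matrix.mul_diagonal,
      Matrix.transpose_apply]
    rw [hK x (hGT x.2) y (hGT y.2), Finset.sum_coe_sort G fun z => L x z * D z * L y z]
    refine (Finset.sum_subset hGT fun z hz hzG => ?_).symm
    have : L x z = 0 := by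
      by_contra hne
      exact hzG (hG x x.2 z hz hne)
    simp [this]
  rw [h, Matrix.det_mul, Matrix.det_mul, Matrix.det_transpose, Matrix.det_diagonal,
    det_eq_prod_diag_of_injective (fun x : G => f x) (hf.comp Subtype.val_injective)
      (Matrix.of fun x y : G => L x y)
      (fun x y => hL x y)]
  simp only [Matrix.of_apply]
  rw [← Finset.prod_coe_sort G, ← Finset.prod_mul_distrib, ← Finset.prod_mul_distrib]
  exact Finset.prod_congr rfl fun x _ => by ring

/-- The first index at which a point occurs in a sequence of designs. -/
def level {α : Type*} (Y : ℕ → Finset α) (x : α) : ℕ :=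
  sInf {j | x ∈ Y j}

theorem mem_iff_level_le {α : Type*} {Y : ℕ → Finset α} (hY : Monotone Y) {N : ℕ} {x : α}
    (hx : x ∈ Y N) {j : ℕ} : x ∈ Y j ↔ level Y x ≤ j :=
  ⟨fun h => Nat.sInf_le h, fun h => hY h (Nat.sInf_mem (s := {j | x ∈ Y j}) ⟨N, hx⟩)⟩

theorem one_le_level {α : Type*} {Y : ℕ → Finset α} (hY : Monotone Y) (h0 : Y 0 = ∅) {N : ℕ}
    {x : α} (hx : x ∈ Y N) : 1 ≤ level Y x := by
  by_contra! h
  have := (mem_iff_level_le hY hx (j := 0)).2 (by omega)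
  simp [h0] at this

theorem mem_sdiff_iff_level_eq {α : Type*} [DecidableEq α] {Y : ℕ → Finset α} (hY : Monotone Y)
    {N : ℕ} {x : α} (hx : x ∈ Y N) {j : ℕ} (hj : 1 ≤ j) :
    x ∈ Y j \ Y (j - 1) ↔ level Y x = j := by
  rw [Finset.mem_sdiff, mem_iff_level_le hY hx, mem_iff_level_le hY hx]
  omega

/-- Each component of a multi-index with positive entries is bounded by its excess over the
minimal sum. -/
theorem apply_le_sub_add_one {d η : ℕ} {j : Fin d → ℕ} (h1 : ∀ i, 1 ≤ j i) (hj : ∑ i, j i ≤ η)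
    (i : Fin d) : j i ≤ η - d + 1 := by
  have h : ∑ k ∈ Finset.univ.erase i, 1 ≤ ∑ k ∈ Finset.univ.erase i, j k :=
    Finset.sum_le_sum fun k _ => h1 k
  have h' := Finset.add_sum_erase Finset.univ j (Finset.mem_univ i)
  simp at h
  omega

theorem mem_idxJ {d η : ℕ} {j : Fin d → ℕ} :
    j ∈ idxJ d η ↔ (∀ i, 1 ≤ j i) ∧ ∑ i, j i ≤ η := by
  simp only [idxJ, Finset.mem_filter, Fintype.mem_piFinset, Finset.mem_Icc]
  exact ⟨fun h => ⟨fun i => (h.1 i).1, h.2⟩, fun h => ⟨fun i => ⟨h.1 i,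
    (Finset.single_le_sum (fun k _ => Nat.zero_le (j k)) (Finset.mem_univ i)).trans h.2⟩, h.2⟩⟩

theorem mem_idxE {d η : ℕ} {j : Fin d → ℕ} :
    j ∈ idxE d η ↔ (∀ i, 1 ≤ j i) ∧ ∑ i, j i = η := by
  simp only [idxE, Finset.mem_filter, Fintype.mem_piFinset, Finset.mem_Icc]
  exact ⟨fun h => ⟨fun i => (h.1 i).1, h.2⟩, fun h => ⟨fun i => ⟨h.1 i,
    (Finset.single_le_sum (fun k _ => Nat.zero_le (j k)) (Finset.mem_univ i)).trans h.2.le⟩, h.2⟩⟩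

/-- The sparse grid consists of the points of the full grid whose levels sum to at most `η`. -/
theorem mem_sparseGrid_iff {d η : ℕ} (hd : 1 ≤ d) {X : Fin d → ℕ → Finset ℝ}
    (hX0 : ∀ i, X i 0 = ∅) (hmono : ∀ i, Monotone (X i)) {x : Fin d → ℝ} :
    x ∈ sparseGrid X η ↔
      (∀ i, x i ∈ X i (η - d + 1)) ∧ ∑ i, level (X i) (x i) ≤ η := by
  simp only [sparseGrid, lattice, Finset.mem_biUnion, Fintype.mem_piFinset, mem_idxE]
  constructor
  · rintro ⟨j, ⟨h1, hj⟩, hx⟩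
    refine ⟨fun i => hmono i (apply_le_sub_add_one h1 hj.le i) (hx i), ?_⟩
    rw [← hj]
    exact Finset.sum_le_sum fun i _ => (mem_iff_level_le (hmono i) (hx i)).1 (hx i)
  · rintro ⟨hx, hle⟩
    refine ⟨fun i => level (X i) (x i) +
      (Pi.single ⟨0, hd⟩ (η - ∑ i, level (X i) (x i)) : Fin d → ℕ) i, ⟨fun i => ?_, ?_⟩,
      fun i => ?_⟩
    · exact (one_le_level (hmono i) (hX0 i) (hx i)).trans (Nat.le_add_right _ _)
    · rw [Finset.sum_add_distrib, Finset.sum_pi_single']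
      simp
      omega
    · exact (mem_iff_level_le (hmono i) (hx i)).2 (Nat.le_add_right _ _)

/-- The increments of the lattice designs partition the sparse grid. -/
theorem sum_sparseGrid_eq {d η : ℕ} (hd : 1 ≤ d) {X : Fin d → ℕ → Finset ℝ}
    (hX0 : ∀ i, X i 0 = ∅) (hmono : ∀ i, Monotone (X i)) (g : (Fin d → ℝ) → ℝ) :
    ∑ x ∈ sparseGrid X η, g x =
      ∑ j ∈ idxJ d η, ∑ x ∈ Fintype.piFinset fun i => X i (j i) \ X i (j i - 1), g x := by
  rw [← Finset.sum_fiberwise_of_maps_to (t := idxJ d η) (g := fun x i => level (X i) (x i))]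
  · refine Finset.sum_congr rfl fun j hj => Finset.sum_congr ?_ fun _ _ => rfl
    obtain ⟨h1, hj⟩ := mem_idxJ.1 hj
    ext x
    simp only [Finset.mem_filter, mem_sparseGrid_iff hd hX0 hmono, Fintype.mem_piFinset]
    constructor
    · rintro ⟨⟨hx, -⟩, rfl⟩ i
      exact (mem_sdiff_iff_level_eq (hmono i) (hx i) (h1 i)).2 rfl
    · intro hx
      have hx' : ∀ i, x i ∈ X i (j i) := fun i => (Finset.mem_sdiff.1 (hx i)).1
      have hl : (fun i => level (X i) (x i)) = j := funext fun i =>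
        (mem_sdiff_iff_level_eq (hmono i) (hx' i) (h1 i)).1 (hx i)
      refine ⟨⟨fun i => hmono i (apply_le_sub_add_one h1 hj i) (hx' i), ?_⟩, hl⟩
      simpa [← hl] using hj
  · intro x hx
    rw [mem_sparseGrid_iff hd hX0 hmono] at hx
    exact mem_idxJ.2 ⟨fun i => one_le_level (hmono i) (hX0 i) (hx.1 i), hx.2⟩

/-- A sum of one-variable functions over a product set. -/
theorem sum_piFinset_sum_apply {ι α : Type*} [Fintype ι] [DecidableEq ι] (Y : ι → Finset α)
    (g : ι → α → ℝ) :
    ∑ x ∈ Fintype.piFinset Y, ∑ i, g i (x i) =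
      ∑ i, (∑ a ∈ Y i, g i a) * ∏ k ∈ Finset.univ.erase i, ((Y k).card : ℝ) := by
  rw [Finset.sum_comm]
  refine Finset.sum_congr rfl fun i _ => ?_
  have h := Finset.prod_univ_sum Y fun k a => if k = i then g i a else 1
  rw [← Finset.mul_prod_erase _ _ (Finset.mem_univ i)] at h
  have e1 : ∏ k ∈ Finset.univ.erase i, ∑ a ∈ Y k, (if k = i then g i a else 1) =
      ∏ k ∈ Finset.univ.erase i, ((Y k).card : ℝ) :=
    Finset.prod_congr rfl fun k hk => by simp [Finset.ne_of_mem_erase hk]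
  rw [e1] at h
  simp only [if_true] at h
  rw [h]
  refine Finset.sum_congr rfl fun x _ => ?_
  rw [Finset.prod_ite_eq' Finset.univ i fun k => g i (x k)]
  simp

/-- **Theorem 1**: the log-determinant formula for sparse grid covariance matrices. -/
theorem logdet_sparse_grid_covariance (d η : ℕ) (hd : 1 ≤ d) (hη : d ≤ η)
    (X : Fin d → ℕ → Finset ℝ) (hX0 : ∀ i, X i 0 = ∅)
    (hnest : ∀ i j, X i j ⊆ X i (j + 1))
    (C : Fin d → ℝ → ℝ → ℝ)
    (hS : ∀ (i : Fin d) (j : ℕ), 1 ≤ j → j ≤ η - d + 1 → (Smat X C i j).PosDef) :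
    Real.log (SigmaMat X C η).det =
      ∑ j ∈ idxJ d η, ∑ i : Fin d,
        (Real.log (Smat X C i (j i)).det - Real.log (Smat X C i (j i - 1)).det) *
          ∏ k ∈ Finset.univ.erase i,
            (((X k (j k)).card : ℝ) - ((X k (j k - 1)).card : ℝ)) := by
  have hmono : ∀ i, Monotone (X i) := fun i => monotone_nat_of_le_succ (hnest i)
  let f : Fin d → ℝ → ℕ ×ₗ ℝ := fun i x => toLex (level (X i) x, x)
  have hf : ∀ i, Function.Injective (f i) := fun i x y h =>
    congrArg Prod.snd (toLex.injective h)
  have hlevel : ∀ i x y, f i y ≤ f i x → level (X i) y ≤ level (X i) x := fun i x y h =>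
    Prod.Lex.monotone_fst _ _ h
  choose L D hL hK using fun i => exists_ldl_finset (f i) (hf i) (X i (η - d + 1)) (C i)
    (hS i (η - d + 1) (by omega) le_rfl)
  have hdet : ∀ i j, j ≤ η - d + 1 → (Smat X C i j).det = ∏ x ∈ X i j, L i x x ^ 2 * D i x :=
    fun i j hj => det_ldl_finset (f i) (hf i) (hmono i hj) (hL i) (hK i) fun x hx y hy hne =>
      (mem_iff_level_le (hmono i) hy).2
        ((hlevel i x y (hL i x y hne)).trans ((mem_iff_level_le (hmono i) hx).1 hx))
  have hpivot : ∀ i, ∀ x ∈ X i (η - d + 1), L i x x ^ 2 * D i x ≠ 0 := fun i =>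
    Finset.prod_ne_zero_iff.1 (hdet i _ le_rfl ▸ (hS i (η - d + 1) (by omega) le_rfl).det_pos.ne')
  have hlog : ∀ i j, j ≤ η - d + 1 →
      Real.log (Smat X C i j).det = ∑ x ∈ X i j, Real.log (L i x x ^ 2 * D i x) := fun i j hj => by
    rw [hdet i j hj, Real.log_prod fun x hx => hpivot i x (hmono i hj hx)]
  have hSigma : (SigmaMat X C η).det =
      ∏ x ∈ sparseGrid X η, (∏ i, L i (x i) (x i)) ^ 2 * ∏ i, D i (x i) := by
    refine det_ldl_finset (T := Fintype.piFinset fun i => X i (η - d + 1))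
      (K := fun x y => ∏ i, C i (x i) (y i)) (L := fun x y => ∏ i, L i (x i) (y i))
      (D := fun x => ∏ i, D i (x i))
      (fun x => toLex fun i => f i (x i)) (fun x y h => funext fun i => ?_) (fun x hx => ?_)
      (fun x y hne => ?_) (fun x hx y hy => ?_) (fun x hx y hy hne => ?_)
    · exact hf i (congrFun (toLex.injective h) i)
    · exact Fintype.mem_piFinset.2 ((mem_sparseGrid_iff hd hX0 hmono).1 hx).1
    · exact Pi.toLex_monotone fun i =>
        hL i _ _ (Finset.prod_ne_zero_iff.1 hne i (Finset.mem_univ i))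
    · rw [Fintype.mem_piFinset] at hx hy
      simp only [hK _ _ (hx _) _ (hy _), Finset.prod_univ_sum, Finset.prod_mul_distrib]
    · rw [mem_sparseGrid_iff hd hX0 hmono] at hx ⊢
      refine ⟨Fintype.mem_piFinset.1 hy, le_trans (Finset.sum_le_sum fun i _ => ?_) hx.2⟩
      exact hlevel i _ _ (hL i _ _ (Finset.prod_ne_zero_iff.1 hne i (Finset.mem_univ i)))
  have hlogSigma : Real.log (SigmaMat X C η).det =
      ∑ x ∈ sparseGrid X η, ∑ i, Real.log (L i (x i) (x i) ^ 2 * D i (x i)) := by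
    simp only [hSigma, ← Finset.prod_pow, ← Finset.prod_mul_distrib]
    have hne : ∀ x ∈ sparseGrid X η, ∀ i, L i (x i) (x i) ^ 2 * D i (x i) ≠ 0 := fun x hx i =>
      hpivot i _ (((mem_sparseGrid_iff hd hX0 hmono).1 hx).1 i)
    rw [Real.log_prod fun x hx => Finset.prod_ne_zero_iff.2 fun i _ => hne x hx i]
    exact Finset.sum_congr rfl fun x hx => Real.log_prod fun i _ => hne x hx i
  rw [hlogSigma, sum_sparseGrid_eq hd hX0 hmono]
  refine Finset.sum_congr rfl fun j hj => ?_
  obtain ⟨h1, hj⟩ := mem_idxJ.1 hj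
  have hjN := apply_le_sub_add_one h1 hj
  rw [sum_piFinset_sum_apply (fun i => X i (j i) \ X i (j i - 1))
    fun i a => Real.log (L i a a ^ 2 * D i a)]
  refine Finset.sum_congr rfl fun i _ => ?_
  have hsub : ∀ k, X k (j k - 1) ⊆ X k (j k) := fun k => hmono k (Nat.sub_le _ _)
  rw [hlog i _ (hjN i), hlog i _ ((Nat.sub_le _ _).trans (hjN i)),
    Finset.sum_sdiff_eq_sub (hsub i)]
  congr 1
  exact Finset.prod_congr rfl fun k _ => Finset.cast_card_sdiff (hsub k)
end
end

section
/- Correctness of the fast sparse grid algorithm (Algorithms 1 and 2): Assume every matrix S_{i,j} for 1 ≤ i ≤ d and 1 ≤ j ≤ η−d+1 is positive definite (hence invertible, and Σ is invertible). For j ∈ P(η) write L(j) = X_{1,j_1} × ⋯ × X_{d,j_d} ⊆ X_SG(η). For any vector v ∈ ℝ^{X_SG(η)}, define w ∈ ℝ^{X_SG(η)} by w_x = Σ_{j ∈ P(η) with x ∈ L(j)} a(j) · ( (S_{1,j_1}^{-1} ⊗ ⋯ ⊗ S_{d,j_d}^{-1}) · v|_{L(j)} )_x, where v|_{L(j)}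 is the restriction of v to the coordinates in L(j) and the Kronecker product matrix is indexed by L(j). Then Σ · w = v; equivalently w = Σ^{-1} v. -/
open Finset Matrix

noncomputable section

/-- The index set `P(η)`: multi-indices with all entries at least 1 and
`max(d, η−d+1) ≤ ∑ j i ≤ η`. -/
def idxP (d η : ℕ) : Finset (Fin d → ℕ) :=
  (Fintype.piFinset fun _ : Fin d => Finset.Icc 1 η).filter fun j =>
    max d (η - d + 1) ≤ ∑ i, j i ∧ ∑ i, j i ≤ η

/-- The Smolyak coefficient `a(j) = (−1)^{η−|j|} · binom(d−1, η−|j|)`. -/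
def aCoef (d η : ℕ) (j : Fin d → ℕ) : ℝ :=
  (-1 : ℝ) ^ (η - ∑ i, j i) * ((d - 1).choose (η - ∑ i, j i) : ℝ)

lemma mem_lattice {d : ℕ} {X : Fin d → ℕ → Finset ℝ} {j : Fin d → ℕ} {x : Fin d → ℝ}
    (hx : x ∈ lattice X j) (i : Fin d) : x i ∈ X i (j i) :=
  Fintype.mem_piFinset.mp hx i

/-- The Kronecker product `S_{1,j_1}^{-1} ⊗ ⋯ ⊗ S_{d,j_d}^{-1}`, indexed by the lattice `L(j)`. -/
def kronInv {d : ℕ} (X : Fin d → ℕ → Finset ℝ) (C : Fin d → ℝ → ℝ → ℝ) (j : Fin d → ℕ) :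
    Matrix ↥(lattice X j) ↥(lattice X j) ℝ :=
  Matrix.of fun x y => ∏ i,
    (Smat X C i (j i))⁻¹ ⟨x.1 i, mem_lattice x.2 i⟩ ⟨y.1 i, mem_lattice y.2 i⟩

/-- The restriction `v|_{L(j)}` of a vector `v ∈ ℝ^{X_SG(η)}` to the coordinates in the
lattice `L(j)` (all of which lie in `X_SG(η)` when `j ∈ P(η)`). -/
def restr {d : ℕ} (X : Fin d → ℕ → Finset ℝ) (η : ℕ) (v : ↥(sparseGrid X η) → ℝ)
    (j : Fin d → ℕ) : ↥(lattice X j) → ℝ :=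
  fun y => if h : y.1 ∈ sparseGrid X η then v ⟨y.1, h⟩ else 0

namespace PowerSeries

lemma coeff_one_sub_X_pow {R : Type*} [CommRing R] (n m : ℕ) :
    coeff m ((1 - X : PowerSeries R) ^ n) = (-1) ^ m * (n.choose m : R) := by
  have h : (1 - X : PowerSeries R) ^ n =
      rescale (-1 : R) (((1 + Polynomial.X) ^ n : Polynomial R)) := by
    simp [sub_eq_add_neg]
  rw [h, coeff_rescale, Polynomial.coeff_coe, Polynomial.coeff_one_add_X_pow]

lemma mk_mul_one_sub_X_eq_coe {R : Type*} [CommRing R] {f : ℕ → R} (hf0 : f 0 = 0) {k : ℕ} {c : R}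
    (hf : ∀ j, k ≤ j → f j = c) :
    mk f * (1 - X) =
      ((∑ j ∈ range k, Polynomial.monomial (j + 1) (f (j + 1) - f j) : Polynomial R) :
        PowerSeries R) := by
  ext n
  rw [Polynomial.coeff_coe, Polynomial.finsetSum_coeff, mul_sub, mul_one, map_sub]
  simp only [Polynomial.coeff_monomial]
  cases n with
  | zero => simp [hf0]
  | succ n =>
    rw [coeff_succ_mul_X]
    simp only [coeff_mk, add_left_inj, Finset.sum_ite_eq', mem_range]
    split_ifs with h
    · rfl
    · rw [hf n (by omega), hf (n + 1) (by omega), sub_self]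

end PowerSeries

lemma aCoef_eq_coeff {d η : ℕ} {j : Fin d → ℕ} :
    aCoef d η j =
      PowerSeries.coeff (η - ∑ i, j i) ((1 - PowerSeries.X : PowerSeries ℝ) ^ (d - 1)) := by
  rw [PowerSeries.coeff_one_sub_X_pow, aCoef]

/-- The weighted sum over `P(η)` as a coefficient of a product of generating functions. -/
lemma sum_aCoef_mul_prod_eq_coeff {d η : ℕ} (hd : 1 ≤ d) (hη : d ≤ η) {f : Fin d → ℕ → ℝ}
    (hf0 : ∀ i, f i 0 = 0) :
    ∑ j ∈ idxP d η, aCoef d η j * ∏ i, f i (j i) =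
      PowerSeries.coeff η
        ((∏ i, PowerSeries.mk (f i)) * (1 - PowerSeries.X : PowerSeries ℝ) ^ (d - 1)) := by
  rw [PowerSeries.coeff_mul, Nat.sum_antidiagonal_eq_sum_range_succ_mk]
  simp only [PowerSeries.coeff_prod, PowerSeries.coeff_mk]
  rw [← Finset.sum_fiberwise_of_maps_to (t := range η.succ) (g := fun j => ∑ i, j i)
    (fun j hj => by simp only [idxP, Finset.mem_filter] at hj; simp; omega)]
  refine Finset.sum_congr rfl fun b hb => ?_
  have hb : b ≤ η := by simpa [Nat.lt_succ_iff] using hb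
  rw [Finset.sum_mul]
  have hinj : Function.Injective fun l : Fin d →₀ ℕ => (l : Fin d → ℕ) := DFunLike.coe_injective
  rw [← Finset.sum_image (s := finsuppAntidiag univ b)
    (f := fun j : Fin d → ℕ => (∏ i, f i (j i)) *
      PowerSeries.coeff (η - b) ((1 - PowerSeries.X : PowerSeries ℝ) ^ (d - 1)))
    (g := fun l : Fin d →₀ ℕ => (l : Fin d → ℕ)) hinj.injOn]
  have hcongr : ∀ j ∈ (idxP d η).filter (fun j => ∑ i, j i = b),
      aCoef d η j * ∏ i, f i (j i) = (∏ i, f i (j i)) *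
      PowerSeries.coeff (η - b) ((1 - PowerSeries.X : PowerSeries ℝ) ^ (d - 1)) := by
    intro j hj
    rw [aCoef_eq_coeff, (Finset.mem_filter.mp hj).2, mul_comm]
  rw [Finset.sum_congr rfl hcongr]
  refine Finset.sum_subset ?_ ?_
  · intro j hj
    rw [Finset.mem_image]
    exact ⟨Finsupp.equivFunOnFinite.symm j, by simp [(Finset.mem_filter.mp hj).2], by simp⟩
  · intro j hj hj'
    obtain ⟨l, hl, rfl⟩ := Finset.mem_image.mp hj
    have hsum : ∑ i, l i = b := (mem_finsuppAntidiag.mp hl).1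
    by_cases h1 : ∀ i, 1 ≤ l i
    · have hdb : d ≤ b := by
        rw [← hsum]
        simpa using Finset.sum_le_sum (s := univ) fun i _ => h1 i
      have hlt : d - 1 < η - b := by
        by_contra hcon
        refine hj' (Finset.mem_filter.mpr ⟨?_, hsum⟩)
        refine Finset.mem_filter.mpr ⟨Fintype.mem_piFinset.mpr fun i => ?_, ?_, ?_⟩
        · have := Finset.single_le_sum (f := fun i => l i) (fun _ _ => Nat.zero_le _)
            (Finset.mem_univ i)
          simp only [Finset.mem_Icc]
          exact ⟨h1 i, by omega⟩
        · rw [hsum]; omega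
        · rw [hsum]; exact hb
      rw [PowerSeries.coeff_one_sub_X_pow, Nat.choose_eq_zero_of_lt hlt]
      simp
    · push Not at h1
      obtain ⟨i, hi⟩ := h1
      have hi0 : l i = 0 := by omega
      rw [Finset.prod_eq_zero (Finset.mem_univ i) (by simp [hi0, hf0]), zero_mul]

/-- The Smolyak combination of products of sequences which are constant from `k i` on reproduces
the product of their limits as soon as `∑ i, k i = η`. -/
lemma sum_aCoef_mul_prod {d η : ℕ} (hd : 1 ≤ d) (hη : d ≤ η) {f : Fin d → ℕ → ℝ}
    (hf0 : ∀ i, f i 0 = 0) {k : Fin d → ℕ} (hk : ∑ i, k i = η) {c : Fin d → ℝ}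
    (hf : ∀ i j, k i ≤ j → f i j = c i) :
    ∑ j ∈ idxP d η, aCoef d η j * ∏ i, f i (j i) = ∏ i, c i := by
  rw [sum_aCoef_mul_prod_eq_coeff hd hη hf0]
  set G : Fin d → Polynomial ℝ := fun i =>
    ∑ j ∈ range (k i), Polynomial.monomial (j + 1) (f i (j + 1) - f i j) with hG
  have hdeg : (∏ i, G i).natDegree ≤ η := by
    refine (Polynomial.natDegree_prod_le _ _).trans (hk ▸ Finset.sum_le_sum fun i _ => ?_)
    refine Polynomial.natDegree_sum_le_of_forall_le _ _ fun j hj => ?_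
    exact (Polynomial.natDegree_monomial_le _).trans (mem_range.mp hj)
  have heval : ∀ i, (G i).eval 1 = c i := by
    intro i
    simp only [hG, Polynomial.eval_finsetSum, Polynomial.eval_monomial, one_pow, mul_one]
    rw [Finset.sum_range_sub, hf0, sub_zero, hf i _ le_rfl]
  have hprod : (∏ i, PowerSeries.mk (f i)) * (1 - PowerSeries.X : PowerSeries ℝ) ^ (d - 1) =
      ((∏ i, G i : Polynomial ℝ) : PowerSeries ℝ) * PowerSeries.mk 1 := by
    have h1 : ((∏ i, G i : Polynomial ℝ) : PowerSeries ℝ) =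
        (∏ i, PowerSeries.mk (f i)) * (1 - PowerSeries.X : PowerSeries ℝ) ^ d := by
      rw [← Polynomial.coeToPowerSeries.ringHom_apply, map_prod]
      simp only [Polynomial.coeToPowerSeries.ringHom_apply, hG,
        ← PowerSeries.mk_mul_one_sub_X_eq_coe (hf0 _) (hf _)]
      simp [Finset.prod_mul_distrib]
    obtain ⟨n, rfl⟩ : ∃ n, d = n + 1 := ⟨d - 1, by omega⟩
    rw [h1, pow_succ, mul_assoc, mul_assoc, mul_comm (1 - PowerSeries.X) (PowerSeries.mk 1),
      PowerSeries.mk_one_mul_one_sub_eq_one]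
    simp
  rw [hprod, PowerSeries.coeff_mul, Nat.sum_antidiagonal_eq_sum_range_succ_mk]
  simp only [Polynomial.coeff_coe, PowerSeries.coeff_mk, Pi.one_apply, mul_one]
  simp only [← heval]
  rw [← Polynomial.eval_prod, Polynomial.eval_eq_sum_range' (Nat.lt_succ_of_le hdeg)]
  simp

/-- The entries of `S_{i,j}⁻¹`, extended by zero to all pairs of real numbers. -/
def SmatInvExt {d : ℕ} (X : Fin d → ℕ → Finset ℝ) (C : Fin d → ℝ → ℝ → ℝ) (i : Fin d) (j : ℕ)
    (y z : ℝ) : ℝ :=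
  if h : y ∈ X i j ∧ z ∈ X i j then (Smat X C i j)⁻¹ ⟨y, h.1⟩ ⟨z, h.2⟩ else 0

/-- The weight of the observation at `z` in the one-dimensional predictor at `x` based on the
component design `X i j`. -/
def predWeight {d : ℕ} (X : Fin d → ℕ → Finset ℝ) (C : Fin d → ℝ → ℝ → ℝ) (i : Fin d) (j : ℕ)
    (x z : ℝ) : ℝ :=
  ∑ y ∈ X i j, C i x y * SmatInvExt X C i j y z

section

variable {d : ℕ} {X : Fin d → ℕ → Finset ℝ} {C : Fin d → ℝ → ℝ → ℝ}

lemma predWeight_eq_zero {i : Fin d} {j : ℕ} {x z : ℝ} (hz : z ∉ X i j) :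
    predWeight X C i j x z = 0 :=
  Finset.sum_eq_zero fun y _ => by simp [SmatInvExt, hz]

lemma predWeight_of_mem {i : Fin d} {j : ℕ} (hS : (Smat X C i j).PosDef) {x : ℝ}
    (hx : x ∈ X i j) (z : ℝ) : predWeight X C i j x z = if x = z then 1 else 0 := by
  by_cases hz : z ∈ X i j
  · have hinv : Smat X C i j * (Smat X C i j)⁻¹ = 1 :=
      Matrix.mul_nonsing_inv _ ((Matrix.isUnit_iff_isUnit_det _).mp hS.isUnit)
    have h := congrFun (congrFun hinv ⟨x, hx⟩) ⟨z, hz⟩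
    rw [Matrix.mul_apply, Matrix.one_apply] at h
    simp only [Subtype.mk.injEq] at h
    rw [← h, predWeight, ← Finset.sum_coe_sort]
    refine Finset.sum_congr rfl fun y _ => ?_
    simp [SmatInvExt, hz, Smat]
  · rw [predWeight_eq_zero hz, if_neg]
    rintro rfl
    exact hz hx

lemma kronInv_apply {j : Fin d → ℕ} (y z : ↥(lattice X j)) :
    kronInv X C j y z = ∏ i, SmatInvExt X C i (j i) (y.1 i) (z.1 i) := by
  rw [kronInv, Matrix.of_apply]
  refine Finset.prod_congr rfl fun i _ => ?_
  rw [SmatInvExt, dif_pos ⟨mem_lattice y.2 i, mem_lattice z.2 i⟩]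

lemma lattice_subset_sparseGrid {η : ℕ} (hd : 1 ≤ d) (hnest : ∀ i j, X i j ⊆ X i (j + 1))
    {j : Fin d → ℕ} (hj : j ∈ idxP d η) : lattice X j ⊆ sparseGrid X η := by
  intro x hx
  simp only [idxP, Finset.mem_filter, Fintype.mem_piFinset, Finset.mem_Icc] at hj
  obtain ⟨hj1, -, hjη⟩ := hj
  let i₀ : Fin d := ⟨0, hd⟩
  have hle : ∀ i, j i ≤ (j + Pi.single i₀ (η - ∑ i, j i) : Fin d → ℕ) i := fun i => by simp
  have hsum : ∑ i, (j + Pi.single i₀ (η - ∑ i, j i) : Fin d → ℕ) i = η := by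
    simp only [Pi.add_apply, Finset.sum_add_distrib, Finset.sum_pi_single', Finset.mem_univ,
      if_true]
    omega
  refine Finset.mem_biUnion.mpr ⟨j + Pi.single i₀ (η - ∑ i, j i), ?_, ?_⟩
  · refine Finset.mem_filter.mpr ⟨Fintype.mem_piFinset.mpr fun i => Finset.mem_Icc.mpr
      ⟨(hj1 i).1.trans (hle i), ?_⟩, hsum⟩
    conv_rhs => rw [← hsum]
    exact Finset.single_le_sum
      (f := fun i => (j + Pi.single i₀ (η - ∑ i, j i) : Fin d → ℕ) i)
      (fun _ _ => Nat.zero_le _) (Finset.mem_univ i)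
  · exact Fintype.mem_piFinset.mpr fun i =>
      monotone_nat_of_le_succ (fun n => hnest i n) (hle i) (mem_lattice hx i)

/-- Applying a row of `Σ` to one term of the algorithm gives a product of predictor weights. -/
lemma sum_prod_mul_kronInv_mulVec {j : Fin d → ℕ} (x : Fin d → ℝ) (u : ↥(lattice X j) → ℝ) :
    ∑ y : ↥(lattice X j), (∏ i, C i (x i) (y.1 i)) * (kronInv X C j *ᵥ u) y =
      ∑ z : ↥(lattice X j), (∏ i, predWeight X C i (j i) (x i) (z.1 i)) * u z := by
  simp only [Matrix.mulVec, dotProduct, Finset.mul_sum]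
  rw [Finset.sum_comm]
  refine Finset.sum_congr rfl fun z _ => ?_
  simp only [predWeight, Finset.prod_univ_sum]
  conv_rhs => rw [← lattice, Finset.sum_mul, ← Finset.sum_coe_sort]
  refine Finset.sum_congr rfl fun y _ => ?_
  rw [kronInv_apply, Finset.prod_mul_distrib, mul_assoc]

lemma le_of_sum_le {η : ℕ} {j : Fin d → ℕ} (h1 : ∀ i, 1 ≤ j i) (hj : ∑ i, j i ≤ η)
    (i : Fin d) : j i ≤ η - d + 1 := by
  have h := Finset.add_sum_erase univ j (Finset.mem_univ i)
  have h2 : d - 1 ≤ ∑ i ∈ univ.erase i, j i := by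
    simpa using Finset.sum_le_sum (s := univ.erase i) (f := fun _ => 1) (g := j) fun i _ => h1 i
  omega

end

/-- A sum over a finite set, rewritten as a sum over a larger one with zero extension. -/
lemma sum_coe_eq_sum_coe_dite {α M : Type*} [DecidableEq α] [AddCommMonoid M]
    {s t : Finset α} (hst : s ⊆ t) (g : ↥s → M) :
    ∑ y : ↥s, g y = ∑ y : ↥t, if h : y.1 ∈ s then g ⟨y.1, h⟩ else 0 := by
  rw [Finset.sum_coe_sort t (fun y => if h : y ∈ s then g ⟨y, h⟩ else 0),
    ← Finset.sum_subset hst (fun y _ hy => dif_neg hy),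
    ← Finset.sum_coe_sort s]
  exact Finset.sum_congr rfl fun y _ => by simp

/-- **Correctness of the fast sparse grid algorithm** (Algorithms 1 and 2):
the vector `w` computed by the algorithm, namely
`w_x = Σ_{j ∈ P(η), x ∈ L(j)} a(j) · ((S_{1,j_1}^{-1} ⊗ ⋯ ⊗ S_{d,j_d}^{-1}) v|_{L(j)})_x`,
satisfies `Σ · w = v`. -/
theorem fast_sparse_grid_algorithm_correct (d η : ℕ) (hd : 1 ≤ d) (hη : d ≤ η)
    (X : Fin d → ℕ → Finset ℝ) (hX0 : ∀ i, X i 0 = ∅)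
    (hnest : ∀ i j, X i j ⊆ X i (j + 1))
    (C : Fin d → ℝ → ℝ → ℝ)
    (hS : ∀ (i : Fin d) (j : ℕ), 1 ≤ j → j ≤ η - d + 1 → (Smat X C i j).PosDef)
    (v : ↥(sparseGrid X η) → ℝ) :
    SigmaMat X C η *ᵥ
        (fun x : ↥(sparseGrid X η) => ∑ j ∈ idxP d η,
          if h : x.1 ∈ lattice X j then
            aCoef d η j * (kronInv X C j *ᵥ restr X η v j) ⟨x.1, h⟩
          else 0) =
      v := by
  classical
  ext x
  obtain ⟨k, hkE, hxk⟩ := Finset.mem_biUnion.mp x.2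
  simp only [idxE, Finset.mem_filter, Fintype.mem_piFinset, Finset.mem_Icc] at hkE
  obtain ⟨hk1, hk⟩ := hkE
  have hkle := le_of_sum_le (fun i => (hk1 i).1) hk.le
  have hdelta : ∀ z : Fin d → ℝ,
      ∑ j ∈ idxP d η, aCoef d η j * ∏ i, predWeight X C i (j i) (x.1 i) (z i) =
        if x.1 = z then 1 else 0 := by
    intro z
    have h := sum_aCoef_mul_prod hd hη
      (f := fun i j => predWeight X C i (min j (η - d + 1)) (x.1 i) (z i))
      (fun i => by simp [predWeight, hX0]) hk (c := fun i => if x.1 i = z i then 1 else 0)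
      (fun i j hij => by
        have hkj : k i ≤ min j (η - d + 1) := le_min hij (hkle i)
        exact predWeight_of_mem (hS i _ ((hk1 i).1.trans hkj) (min_le_right _ _))
          (monotone_nat_of_le_succ (fun n => hnest i n) hkj (mem_lattice hxk i)) _)
    rw [Finset.prod_ite_zero, Finset.prod_const_one] at h
    simp only [Finset.mem_univ, true_implies] at h
    simp only [funext_iff (f := x.1)]
    rw [← h]
    refine Finset.sum_congr rfl fun j hj => ?_
    simp only [idxP, Finset.mem_filter, Fintype.mem_piFinset, Finset.mem_Icc] at hj
    congr 1
    refine Finset.prod_congr rfl fun i _ => ?_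
    rw [min_eq_left (le_of_sum_le (fun i => (hj.1 i).1) hj.2.2 i)]
  have hterm : ∀ j ∈ idxP d η,
      ∑ y : ↥(sparseGrid X η), (∏ i, C i (x.1 i) (y.1 i)) *
        (if h : y.1 ∈ lattice X j then
          aCoef d η j * (kronInv X C j *ᵥ restr X η v j) ⟨y.1, h⟩ else 0) =
      ∑ z : ↥(sparseGrid X η),
        aCoef d η j * (∏ i, predWeight X C i (j i) (x.1 i) (z.1 i)) * v z := by
    intro j hj
    have hsub := lattice_subset_sparseGrid hd hnest hj
    have hl := sum_coe_eq_sum_coe_dite hsub (fun y => (∏ i, C i (x.1 i) (y.1 i)) *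
      (aCoef d η j * (kronInv X C j *ᵥ restr X η v j) y))
    have hr := sum_coe_eq_sum_coe_dite hsub (fun z =>
      aCoef d η j * ((∏ i, predWeight X C i (j i) (x.1 i) (z.1 i)) * restr X η v j z))
    calc _ = ∑ y : ↥(lattice X j), (∏ i, C i (x.1 i) (y.1 i)) *
          (aCoef d η j * (kronInv X C j *ᵥ restr X η v j) y) := by
          rw [hl]
          refine Finset.sum_congr rfl fun y _ => ?_
          split_ifs <;> simp
      _ = ∑ z : ↥(lattice X j), aCoef d η j *
          ((∏ i, predWeight X C i (j i) (x.1 i) (z.1 i)) * restr X η v j z) := by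
          rw [← Finset.mul_sum, ← sum_prod_mul_kronInv_mulVec, Finset.mul_sum]
          exact Finset.sum_congr rfl fun y _ => by ring
      _ = _ := by
          rw [hr]
          refine Finset.sum_congr rfl fun z _ => ?_
          split_ifs with h
          · simp [restr, mul_assoc]
          · obtain ⟨i, hi⟩ : ∃ i, z.1 i ∉ X i (j i) := by
              simpa [lattice, Fintype.mem_piFinset] using h
            rw [Finset.prod_eq_zero (Finset.mem_univ i) (predWeight_eq_zero hi)]
            simp
  calc _ = ∑ j ∈ idxP d η, ∑ y : ↥(sparseGrid X η), (∏ i, C i (x.1 i) (y.1 i)) *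
        (if h : y.1 ∈ lattice X j then
          aCoef d η j * (kronInv X C j *ᵥ restr X η v j) ⟨y.1, h⟩ else 0) := by
        rw [Finset.sum_comm]
        simp only [Matrix.mulVec, dotProduct, SigmaMat, Matrix.of_apply, Finset.mul_sum]
    _ = ∑ z : ↥(sparseGrid X η), (if x = z then 1 else 0) * v z := by
        rw [Finset.sum_congr rfl hterm, Finset.sum_comm]
        refine Finset.sum_congr rfl fun z _ => ?_
        rw [← Finset.sum_mul, hdelta]
        simp only [Subtype.ext_iff]
    _ = v x := by simp
end
end

section
/- Sample size, Table 1 row 1 (exact): Let c ≥ 1 be an integer and suppose the component designs satisfy #X_{i,j} = c·j for all i = 1,…,d and all j ≥ 1. Then #X_SG(η) = c^d · binom(η, d). -/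
open Finset

noncomputable section

/-- The points of the level-`k + 1` component designs that are new at that level. -/
def newPoints {d : ℕ} (X : Fin d → ℕ → Finset ℝ) (k : Fin d → ℕ) : Finset (Fin d → ℝ) :=
  Fintype.piFinset fun i => X i (k i + 1) \ X i (k i)

/-- Multi-indices with `∑ i, k i ≤ m`. -/
def idxLE (d m : ℕ) : Finset (Fin d → ℕ) :=
  (range (m + 1)).biUnion fun n => piAntidiag univ n

lemma mem_idxLE {d m : ℕ} {k : Fin d → ℕ} : k ∈ idxLE d m ↔ ∑ i, k i ≤ m := by
  simp [idxLE, mem_piAntidiag]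

lemma card_piAntidiag_univ (d n : ℕ) :
    (piAntidiag (univ : Finset (Fin d)) n).card = d.multichoose n := by
  rw [card_eq_of_equiv_fintype (β := Sym (Fin d) n), Sym.card_sym_eq_multichoose, Fintype.card_fin]
  exact (Equiv.subtypeEquivRight fun f => by simp).trans (Sym.equivNatSumOfFintype (Fin d) n).symm

lemma card_idxLE (d m : ℕ) : (idxLE d m).card = (m + d).choose d := by
  rw [idxLE, card_biUnion]
  · simp only [card_piAntidiag_univ, Nat.sum_range_multichoose]
  · intro a _ b _ hab
    refine Finset.disjoint_left.2 fun k ha hb => ?_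
    exact hab ((mem_piAntidiag.1 ha).1.symm.trans (mem_piAntidiag.1 hb).1)

lemma disjoint_newPoints {d : ℕ} {X : Fin d → ℕ → Finset ℝ} (hX : ∀ i, Monotone (X i))
    {k l : Fin d → ℕ} (hkl : k ≠ l) : Disjoint (newPoints X k) (newPoints X l) := by
  rw [Finset.disjoint_left]
  intro x hk hl
  simp only [newPoints, Fintype.mem_piFinset, mem_sdiff] at hk hl
  obtain ⟨i, hi⟩ := Function.ne_iff.1 hkl
  rcases lt_or_gt_of_ne hi with h | h
  · exact (hl i).2 (hX i h (hk i).1)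
  · exact (hk i).2 (hX i h (hl i).1)

lemma sparseGrid_eq_biUnion_newPoints {d η : ℕ} (hd : 1 ≤ d) (hη : d ≤ η)
    {X : Fin d → ℕ → Finset ℝ} (hX0 : ∀ i, X i 0 = ∅) (hX : ∀ i, Monotone (X i)) :
    sparseGrid X η = (idxLE d (η - d)).biUnion (newPoints X) := by
  classical
  ext x
  simp only [sparseGrid, idxE, lattice, newPoints, mem_biUnion, mem_filter, mem_idxLE,
    Fintype.mem_piFinset, mem_Icc, mem_sdiff]
  constructor
  · rintro ⟨j, ⟨-, hj⟩, hx⟩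
    have level (i : Fin d) : ∃ k, k + 1 ≤ j i ∧ x i ∈ X i (k + 1) ∧ x i ∉ X i k := by
      have hex : ∃ n, x i ∈ X i n := ⟨j i, hx i⟩
      have hpos : Nat.find hex ≠ 0 := fun h => by
        have := Nat.find_spec hex
        simp [h, hX0] at this
      have hsucc : Nat.find hex - 1 + 1 = Nat.find hex := by lia
      refine ⟨Nat.find hex - 1, ?_, ?_, Nat.find_min hex (by lia)⟩
      · rw [hsucc]
        exact Nat.find_min' hex (hx i)
      · rw [hsucc]
        exact Nat.find_spec hex
    choose k hkj hk using level
    refine ⟨k, ?_, hk⟩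
    have hsum : ∑ i, (k i + 1) ≤ ∑ i, j i := sum_le_sum fun i _ => hkj i
    rw [sum_add_distrib] at hsum
    simp only [sum_const, card_univ, Fintype.card_fin, smul_eq_mul, mul_one] at hsum
    lia
  · rintro ⟨k, hk, hx⟩
    let j : Fin d → ℕ := fun i => k i + 1 + if i = ⟨0, hd⟩ then η - d - ∑ i, k i else 0
    have hj : ∑ i, j i = η := by
      simp only [j, sum_add_distrib, sum_const, card_univ, Fintype.card_fin, smul_eq_mul, mul_one,
        sum_ite_eq', mem_univ, if_true]
      lia
    refine ⟨j, ⟨fun i => ⟨by simp only [j]; lia, ?_⟩, hj⟩, fun i => ?_⟩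
    · rw [← hj]
      exact single_le_sum (fun _ _ => Nat.zero_le _) (mem_univ i)
    · exact hX i (Nat.le_add_right _ _) (hx i).1

/-- Sample size, Table 1 row 1 (exact): if `#X_{i,j} = c·j` then `#X_SG(η) = c^d · C(η,d)`. -/
theorem sample_size_row1_exact (d η : ℕ) (hd : 1 ≤ d) (hη : d ≤ η)
    (X : Fin d → ℕ → Finset ℝ) (hX0 : ∀ i, X i 0 = ∅)
    (hnest : ∀ i j, X i j ⊆ X i (j + 1))
    (c : ℕ) (hc : 1 ≤ c) (hcard : ∀ (i : Fin d) (j : ℕ), 1 ≤ j → (X i j).card = c * j) :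
    (sparseGrid X η).card = c ^ d * η.choose d := by
  have hX (i : Fin d) : Monotone (X i) := monotone_nat_of_le_succ (hnest i)
  have hcard' (i : Fin d) (n : ℕ) : (X i n).card = c * n := by
    rcases n.eq_zero_or_pos with rfl | hn
    · simp [hX0]
    · exact hcard i n hn
  have hnew (k : Fin d → ℕ) : (newPoints X k).card = c ^ d := by
    simp [newPoints, Fintype.card_piFinset, card_sdiff_of_subset (hnest _ _), hcard', mul_add]
  rw [sparseGrid_eq_biUnion_newPoints hd hη hX0 hX,
    card_biUnion fun k _ l _ hkl => disjoint_newPoints hX hkl,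
    sum_congr rfl fun k _ => hnew k, sum_const, smul_eq_mul, card_idxLE,
    Nat.sub_add_cancel hη, mul_comm]
end
end

section
/- Sample size, Table 1 row 2 (exact): Let c ≥ 1 be an integer and suppose the component designs satisfy #X_{i,j} = c·(j−1) + 1 for all i = 1,…,d and all j ≥ 1. Then #X_SG(η) = Σ_{k=0}^{min(d, η−d)} c^k · binom(d, k) · binom(η−d, k). -/
open Finset

noncomputable section

/-- The least `m` such that `x` lies in the member of index `m + 1` of a sequence of designs. -/
def designLevel (Y : ℕ → Finset ℝ) (x : ℝ) : ℕ :=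
  sInf {m | x ∈ Y (m + 1)}

lemma designLevel_le_iff {Y : ℕ → Finset ℝ} (hY : Monotone Y) {x : ℝ} {n : ℕ}
    (hx : x ∈ Y (n + 1)) (m : ℕ) : designLevel Y x ≤ m ↔ x ∈ Y (m + 1) := by
  constructor
  · intro h
    have hne : {m | x ∈ Y (m + 1)}.Nonempty := ⟨n, hx⟩
    exact hY (Nat.succ_le_succ h) (Nat.sInf_mem hne)
  · intro h
    exact Nat.sInf_le h

lemma card_filter_designLevel {Y : ℕ → Finset ℝ} (hY : Monotone Y) {c : ℕ}
    (hcard : ∀ j, 1 ≤ j → (Y j).card = c * (j - 1) + 1) {m n : ℕ} (hm : m ≤ n) :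
    ((Y (n + 1)).filter fun x => designLevel Y x = m).card = if m = 0 then 1 else c := by
  cases m with
  | zero =>
    have h : ((Y (n + 1)).filter fun x => designLevel Y x = 0) = Y 1 := by
      ext x
      rw [mem_filter]
      constructor
      · rintro ⟨hx, h⟩
        exact (designLevel_le_iff hY hx 0).1 h.le
      · intro h
        have hx : x ∈ Y (n + 1) := hY (by omega) h
        exact ⟨hx, Nat.le_zero.1 ((designLevel_le_iff hY hx 0).2 h)⟩
    rw [h, hcard 1 le_rfl]
    simp
  | succ m =>
    have h : ((Y (n + 1)).filter fun x => designLevel Y x = m + 1) =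
        Y (m + 2) \ Y (m + 1) := by
      ext x
      rw [mem_filter, mem_sdiff]
      constructor
      · rintro ⟨hx, h⟩
        rw [← designLevel_le_iff hY hx m, ← designLevel_le_iff hY hx (m + 1)]
        omega
      · rintro ⟨h1, h2⟩
        have hx : x ∈ Y (n + 1) := hY (by omega) h1
        rw [← designLevel_le_iff hY hx m] at h2
        rw [← designLevel_le_iff hY hx (m + 1)] at h1
        exact ⟨hx, by omega⟩
    rw [h, card_sdiff_of_subset (hY (by omega)), hcard _ (by omega), hcard _ (by omega)]
    simp [Nat.mul_succ]

/-- `∑ k, c ^ k * d.choose k * n.choose k`, the sum running over all `k ≤ d`. -/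
def weightedChooseSum (c d n : ℕ) : ℕ :=
  ∑ k ∈ range (d + 1), c ^ k * d.choose k * n.choose k

lemma weightedChooseSum_succ (c d n : ℕ) :
    weightedChooseSum c (d + 1) n =
      weightedChooseSum c d n + c * ∑ m ∈ range n, weightedChooseSum c d m := by
  have hsum (k : ℕ) : ∑ m ∈ range n, m.choose k = n.choose (k + 1) := by
    induction n with
    | zero => simp
    | succ n ih => rw [sum_range_succ, ih, Nat.choose_succ_succ' n k, add_comm]
  have h1 : c * ∑ m ∈ range n, weightedChooseSum c d m =
      ∑ k ∈ range (d + 1), c ^ (k + 1) * d.choose k * n.choose (k + 1) := by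
    simp only [weightedChooseSum]
    rw [sum_comm, mul_sum]
    refine sum_congr rfl fun k _ => ?_
    rw [← mul_sum, hsum]
    ring
  have h2 : weightedChooseSum c d n =
      ∑ k ∈ range (d + 1), c ^ (k + 1) * d.choose (k + 1) * n.choose (k + 1) + 1 := by
    rw [weightedChooseSum, sum_range_succ', sum_range_succ _ d]
    simp
  rw [h1, h2, weightedChooseSum, sum_range_succ']
  simp only [Nat.choose_succ_succ' d, pow_zero, Nat.choose_zero_right, mul_one, mul_add, add_mul,
    sum_add_distrib]
  ring

lemma card_filter_sum_le {α : Type*} [DecidableEq α] (c N : ℕ) :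
    ∀ (d : ℕ) (A : Fin d → Finset α) (l : Fin d → α → ℕ),
      (∀ i, ∀ m ≤ N, ((A i).filter fun x => l i x = m).card = if m = 0 then 1 else c) →
      ∀ n ≤ N, ((Fintype.piFinset A).filter fun x => ∑ i, l i (x i) ≤ n).card =
        weightedChooseSum c d n := by
  intro d
  induction d with
  | zero =>
    intro A l _ n _
    simp [weightedChooseSum]
  | succ d ih =>
    intro A l hA n hn
    have hmaps : Set.MapsTo (fun x : Fin (d + 1) → α => x 0)
        ((Fintype.piFinset A).filter fun x => ∑ i, l i (x i) ≤ n)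
        ((A 0).filter fun a => l 0 a ∈ range (n + 1)) := by
      intro x hx
      simp only [mem_coe, mem_filter, Fintype.mem_piFinset, Fin.sum_univ_succ,
        mem_range] at hx ⊢
      exact ⟨hx.1 0, by omega⟩
    have hfiber (a) (ha : a ∈ (A 0).filter fun a => l 0 a ∈ range (n + 1)) :
        (((Fintype.piFinset A).filter fun x => ∑ i, l i (x i) ≤ n).filter
          fun x => x 0 = a).card = weightedChooseSum c d (n - l 0 a) := by
      rw [mem_filter, mem_range] at ha
      rw [← ih (fun i => A i.succ) (fun i => l i.succ) (fun i => hA i.succ) (n - l 0 a) (by omega)]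
      refine card_nbij' Fin.tail (fun y => (Fin.cons a y : Fin (d + 1) → α)) ?_ ?_ ?_ ?_
      · intro x hx
        simp only [mem_coe, mem_filter, Fintype.mem_piFinset,
          Fin.sum_univ_succ, Fin.tail] at hx ⊢
        obtain ⟨⟨h1, h2⟩, rfl⟩ := hx
        exact ⟨fun i => h1 _, by omega⟩
      · intro x hx
        simp only [mem_coe, mem_filter, Fintype.mem_piFinset,
          Fin.sum_univ_succ, Fin.cons_zero, Fin.cons_succ, Fin.forall_fin_succ] at hx ⊢
        exact ⟨⟨⟨ha.1, hx.1⟩, by omega⟩, trivial⟩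
      · intro x hx
        simp only [mem_coe, mem_filter] at hx
        rw [← hx.2]
        exact Fin.cons_self_tail x
      · intro x _
        exact Fin.tail_cons (α := fun _ => α) a x
    rw [card_eq_sum_card_fiberwise hmaps, sum_congr rfl hfiber,
      ← sum_fiberwise_of_maps_to (t := range (n + 1)) (g := l 0)
        (fun a ha => (mem_filter.1 ha).2)]
    have hlevel (m) (hm : m ∈ range (n + 1)) :
        ∑ a ∈ ((A 0).filter fun a => l 0 a ∈ range (n + 1)).filter (fun a => l 0 a = m),
          weightedChooseSum c d (n - l 0 a) =
        (if m = 0 then 1 else c) * weightedChooseSum c d (n - m) := by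
      have hset : ((A 0).filter fun a => l 0 a ∈ range (n + 1)).filter (fun a => l 0 a = m) =
          (A 0).filter fun a => l 0 a = m := by
        rw [filter_filter]
        refine filter_congr fun a _ => ?_
        exact ⟨fun h => h.2, fun h => ⟨h ▸ hm, h⟩⟩
      rw [mem_range] at hm
      rw [hset, sum_congr rfl (g := fun _ => weightedChooseSum c d (n - m))
        (fun a ha => by rw [(mem_filter.1 ha).2]), sum_const, hA 0 m (by omega), smul_eq_mul]
    rw [sum_congr rfl hlevel, sum_range_succ', weightedChooseSum_succ,
      ← sum_range_reflect (weightedChooseSum c d) n, mul_sum, add_comm]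
    simp [Nat.sub_sub, add_comm]

lemma sparseGrid_eq_filter {d η : ℕ} (hd : 1 ≤ d) (hη : d ≤ η) {X : Fin d → ℕ → Finset ℝ}
    (hX : ∀ i, Monotone (X i)) :
    sparseGrid X η = (Fintype.piFinset fun i => X i (η - d + 1)).filter
      fun x => ∑ i, designLevel (X i) (x i) ≤ η - d := by
  ext x
  simp only [sparseGrid, lattice, idxE, mem_biUnion, mem_filter, Fintype.mem_piFinset, mem_Icc]
  constructor
  · rintro ⟨j, ⟨hj, hsum⟩, hx⟩
    have hsum' : ∑ i, (j i - 1) = η - d := by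
      have h : ∑ i, (j i - 1 + 1) = η := by
        rw [← hsum]
        exact sum_congr rfl fun i _ => Nat.sub_add_cancel (hj i).1
      rw [sum_add_distrib] at h
      simp at h
      omega
    have hx' (i) : x i ∈ X i (j i - 1 + 1) := by
      rw [Nat.sub_add_cancel (hj i).1]
      exact hx i
    refine ⟨fun i => hX i ?_ (hx' i), ?_⟩
    · rw [← hsum']
      exact Nat.succ_le_succ
        (single_le_sum (f := fun i => j i - 1) (fun _ _ => Nat.zero_le _) (mem_univ i))
    · rw [← hsum']
      exact sum_le_sum fun i _ => (designLevel_le_iff (hX i) (hx' i) _).2 (hx' i)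
  · rintro ⟨hx, hle⟩
    let j : Fin d → ℕ := fun i => designLevel (X i) (x i) + 1 +
      if i = ⟨0, hd⟩ then η - d - ∑ i, designLevel (X i) (x i) else 0
    have hsum : ∑ i, j i = η := by
      simp only [j, sum_add_distrib, sum_ite_eq', mem_univ, if_true]
      simp
      omega
    refine ⟨j, ⟨fun i => ⟨by simp only [j]; omega, ?_⟩, hsum⟩, fun i => ?_⟩
    · rw [← hsum]
      exact single_le_sum (fun _ _ => Nat.zero_le _) (mem_univ i)
    · exact hX i (Nat.le_add_right _ _) ((designLevel_le_iff (hX i) (hx i) _).1 le_rfl)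

/-- Sample size, Table 1 row 2 (exact): if `#X_{i,j} = c·(j−1)+1` then
`#X_SG(η) = Σ_{k=0}^{min(d,η−d)} c^k · C(d,k) · C(η−d,k)`. -/
theorem sample_size_row2_exact (d η : ℕ) (hd : 1 ≤ d) (hη : d ≤ η)
    (X : Fin d → ℕ → Finset ℝ) (hX0 : ∀ i, X i 0 = ∅)
    (hnest : ∀ i j, X i j ⊆ X i (j + 1))
    (c : ℕ) (hc : 1 ≤ c)
    (hcard : ∀ (i : Fin d) (j : ℕ), 1 ≤ j → (X i j).card = c * (j - 1) + 1) :
    (sparseGrid X η).card =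
      ∑ k ∈ Finset.range (min d (η - d) + 1), c ^ k * d.choose k * (η - d).choose k := by
  have hX (i) : Monotone (X i) := monotone_nat_of_le_succ (hnest i)
  rw [sparseGrid_eq_filter hd hη hX,
    card_filter_sum_le c (η - d) d (fun i => X i (η - d + 1)) (fun i => designLevel (X i))
      (fun i m hm => card_filter_designLevel (hX i) (hcard i) hm) _ le_rfl, weightedChooseSum]
  symm
  refine sum_subset (range_subset_range.2 (by omega)) fun k hk hk' => ?_
  rw [mem_range] at hk hk'
  rw [Nat.choose_eq_zero_of_lt (n := η - d) (by omega), mul_zero]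
end
end

section
/- Sample size, Table 1 row 2 (bound): Let c ≥ 1 be an integer, suppose the component designs satisfy #X_{i,j} = c·(j−1) + 1 for all i = 1,…,d and all j ≥ 1, and suppose η ≤ 2d. Then #X_SG(η) ≤ c^{η−d} · binom(η, d). -/
open Finset

noncomputable section

/-- The points that a component design gains in passing from level `j` to level `j + 1`. -/
def increment (Y : ℕ → Finset ℝ) (j : ℕ) : Finset ℝ :=
  Y (j + 1) \ Y j

lemma exists_mem_increment {Y : ℕ → Finset ℝ} (h0 : Y 0 = ∅) {x : ℝ} {j : ℕ} (hx : x ∈ Y j) :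
    ∃ k < j, x ∈ increment Y k := by
  induction j with
  | zero => simp [h0] at hx
  | succ j ih =>
    by_cases h : x ∈ Y j
    · obtain ⟨k, hk, hxk⟩ := ih h
      exact ⟨k, hk.trans j.lt_succ_self, hxk⟩
    · exact ⟨j, j.lt_succ_self, mem_sdiff.2 ⟨hx, h⟩⟩

lemma card_increment_le {Y : ℕ → Finset ℝ} (hnest : ∀ j, Y j ⊆ Y (j + 1)) {c : ℕ} (hc : 1 ≤ c)
    (hcard : ∀ j, 1 ≤ j → (Y j).card = c * (j - 1) + 1) (j : ℕ) :
    (increment Y j).card ≤ c ^ j := by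
  cases j with
  | zero => exact (card_le_card sdiff_subset).trans (by simp [hcard 1 le_rfl])
  | succ j =>
    rw [increment, card_sdiff_of_subset (hnest _), hcard _ (by omega), hcard _ (by omega)]
    simp only [Nat.add_sub_cancel, mul_add, mul_one]
    calc c * j + c + 1 - (c * j + 1) = c := by omega
      _ ≤ c ^ (j + 1) := Nat.le_self_pow (by omega) c

/-- Every point of the sparse grid lies in a product of increments whose levels have sum at most
`η - d`; the coordinate at `0` of the index takes up the slack. -/
lemma sparseGrid_subset_biUnion_increment {d : ℕ} (η : ℕ) {X : Fin d → ℕ → Finset ℝ}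
    (hX0 : ∀ i, X i 0 = ∅) :
    sparseGrid X η ⊆ (finsuppAntidiag (univ : Finset (Fin (d + 1))) (η - d)).biUnion
      fun f => Fintype.piFinset fun i => increment (X i) (f i.succ) := by
  intro x hx
  simp only [sparseGrid, idxE, lattice, mem_biUnion, mem_filter, Fintype.mem_piFinset] at hx
  obtain ⟨j, ⟨-, hj⟩, hxj⟩ := hx
  choose k hkj hxk using fun i => exists_mem_increment (hX0 i) (hxj i)
  have hk : ∑ i, k i + d ≤ η :=
    calc ∑ i, k i + d = ∑ i, (k i + 1) := by simp [sum_add_distrib]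
      _ ≤ ∑ i, j i := sum_le_sum fun i _ => hkj i
      _ = η := hj
  refine mem_biUnion.2 ⟨Finsupp.equivFunOnFinite.symm (Fin.cons (η - d - ∑ i, k i) k), ?_, ?_⟩
  · simp only [mem_finsuppAntidiag, subset_univ, and_true, Finsupp.equivFunOnFinite_symm_apply_apply,
      Fin.sum_univ_succ, Fin.cons_zero, Fin.cons_succ]
    omega
  · simpa using hxk

lemma card_piFinset_increment_le {d n : ℕ} {X : Fin d → ℕ → Finset ℝ}
    (hnest : ∀ i j, X i j ⊆ X i (j + 1)) {c : ℕ} (hc : 1 ≤ c)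
    (hcard : ∀ (i : Fin d) (j : ℕ), 1 ≤ j → (X i j).card = c * (j - 1) + 1)
    {k : Fin d → ℕ} (hk : ∑ i, k i ≤ n) :
    (Fintype.piFinset fun i => increment (X i) (k i)).card ≤ c ^ n :=
  calc (Fintype.piFinset fun i => increment (X i) (k i)).card
      = ∏ i, (increment (X i) (k i)).card := Fintype.card_piFinset _
    _ ≤ ∏ i, c ^ k i := prod_le_prod' fun i _ => card_increment_le (hnest i) hc (hcard i) (k i)
    _ = c ^ ∑ i, k i := prod_pow_eq_pow_sum _ _ _
    _ ≤ c ^ n := Nat.pow_le_pow_right hc hk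

/-- Sample size, Table 1 row 2 (bound): if `#X_{i,j} = c·(j−1)+1` and `η ≤ 2d` then
`#X_SG(η) ≤ c^{η−d} · C(η,d)`. -/
theorem sample_size_row2_bound (d η : ℕ) (hd : 1 ≤ d) (hη : d ≤ η) (hη2 : η ≤ 2 * d)
    (X : Fin d → ℕ → Finset ℝ) (hX0 : ∀ i, X i 0 = ∅)
    (hnest : ∀ i j, X i j ⊆ X i (j + 1))
    (c : ℕ) (hc : 1 ≤ c)
    (hcard : ∀ (i : Fin d) (j : ℕ), 1 ≤ j → (X i j).card = c * (j - 1) + 1) :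
    (sparseGrid X η).card ≤ c ^ (η - d) * η.choose d := by
  refine (card_le_card (sparseGrid_subset_biUnion_increment η hX0)).trans ?_
  refine (card_biUnion_le_card_mul _ _ (c ^ (η - d)) fun f hf => ?_).trans_eq ?_
  · refine card_piFinset_increment_le hnest hc hcard ?_
    have hsum := (mem_finsuppAntidiag.1 hf).1
    rw [Fin.sum_univ_succ] at hsum
    omega
  · rw [card_finsuppAntidiag_nat_eq_choose, card_univ, Fintype.card_fin, mul_comm,
      show d + 1 + (η - d) - 1 = η by omega, Nat.choose_symm hη]
end
end

section
/- Kronecker–Schur complement lemma for separable kernels (key step in the proof of Theorem 1): Let T and U be types, K1 : T → T → ℝ and K2 : U → U → ℝ. Let A' ⊆ A be finite subsets of T and let B1, B2 be disjoint finite subsets of U. Write K1[A, A'] for the matrix (K1(u, u'))_{u ∈ A, u' ∈ A'} (and analogously for other index pairs), and assume the square matrices K1[A, A] and K2[B1, B1] are invertible. Let M be the matrix with rows and columns indexed by the disjoint union (A × B1) ⊔ (A' × B2) and entries M((u,s),(v,t)) = K1(u,v)·K2(s,t), partitioned into blocks with first block indexed by A × B1. Then the Schur complement of M with respect to the A ×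 B1 block equals K1[A', A'] ⊗ ( K2[B2, B2] − K2[B2, B1] · K2[B1, B1]^{-1} · K2[B1, B2] ), the Kronecker product being indexed by A' × B2. -/
open Finset Matrix

noncomputable section

/-- The kernel matrix `K[A, B] = (K(u, u'))_{u ∈ A, u' ∈ B}`. -/
def kmat {T : Type*} (K : T → T → ℝ) (A B : Finset T) : Matrix ↥A ↥B ℝ :=
  Matrix.of fun u v => K u.1 v.1

/-- A block of the separable-kernel matrix `M((u,s),(v,t)) = K1(u,v)·K2(s,t)`,
with rows indexed by `P × Q` and columns indexed by `P' × Q'`; this is the Kronecker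
product `K1[P,P'] ⊗ K2[Q,Q']`. -/
def kblock {T U : Type*} (K1 : T → T → ℝ) (K2 : U → U → ℝ)
    (P : Finset T) (Q : Finset U) (P' : Finset T) (Q' : Finset U) :
    Matrix (↥P × ↥Q) (↥P' × ↥Q') ℝ :=
  Matrix.of fun p q => K1 p.1.1 q.1.1 * K2 p.2.1 q.2.1

open scoped Kronecker in
theorem kblock_eq_kronecker {T U : Type*} (K1 : T → T → ℝ) (K2 : U → U → ℝ)
    (P : Finset T) (Q : Finset U) (P' : Finset T) (Q' : Finset U) :
    kblock K1 K2 P Q P' Q' = kmat K1 P P' ⊗ₖ kmat K2 Q Q' :=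
  rfl

/-- A kernel matrix on subsets of `A` is recovered by interpolating through the invertible
matrix `K[A, A]`. -/
theorem kmat_mul_inv_mul_kmat {T : Type*} [DecidableEq T] (K : T → T → ℝ)
    {A P Q : Finset T} (hP : P ⊆ A) (hQ : Q ⊆ A) (h : IsUnit (kmat K A A).det) :
    kmat K P A * (kmat K A A)⁻¹ * kmat K A Q = kmat K P Q := by
  let p : ↥P → ↥A := fun x => ⟨x.1, hP x.2⟩
  let q : ↥Q → ↥A := fun x => ⟨x.1, hQ x.2⟩
  have key : (kmat K A A * (kmat K A A)⁻¹ * kmat K A A).submatrix p q =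
      (kmat K A A).submatrix p q := by
    rw [Matrix.mul_nonsing_inv _ h, Matrix.one_mul]
  exact key

/-- **Kronecker–Schur complement lemma for separable kernels** (key step in the proof of
Theorem 1).  Let `M` be the matrix indexed by `(A × B1) ⊔ (A' × B2)` with entries
`M((u,s),(v,t)) = K1(u,v)·K2(s,t)`, partitioned into blocks with first block indexed by
`A × B1`.  If `A' ⊆ A`, `B1` and `B2` are disjoint, and `K1[A,A]`, `K2[B1,B1]` are
invertible, then the Schur complement of `M` with respect to the `A × B1` block equals
`K1[A',A'] ⊗ (K2[B2,B2] − K2[B2,B1]·K2[B1,B1]^{-1}·K2[B1,B2])`. -/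
theorem kronecker_schur_complement {T U : Type*} [DecidableEq T] [DecidableEq U]
    (K1 : T → T → ℝ) (K2 : U → U → ℝ)
    (A' A : Finset T) (hA : A' ⊆ A) (B1 B2 : Finset U) (hB : Disjoint B1 B2)
    (h1 : IsUnit (kmat K1 A A).det) (h2 : IsUnit (kmat K2 B1 B1).det) :
    kblock K1 K2 A' B2 A' B2 -
        kblock K1 K2 A' B2 A B1 * (kblock K1 K2 A B1 A B1)⁻¹ * kblock K1 K2 A B1 A' B2 =
      Matrix.of fun (p q : ↥A' × ↥B2) =>
        kmat K1 A' A' p.1 q.1 *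
          (kmat K2 B2 B2 - kmat K2 B2 B1 * (kmat K2 B1 B1)⁻¹ * kmat K2 B1 B2) p.2 q.2 := by
  simp only [kblock_eq_kronecker]
  rw [Matrix.inv_kronecker, ← Matrix.mul_kronecker_mul, ← Matrix.mul_kronecker_mul,
    kmat_mul_inv_mul_kmat K1 hA hA h1]
  ext p q
  simp only [Matrix.sub_apply, Matrix.kroneckerMap, Matrix.of_apply, mul_sub]
end
end

section
/- Inductive determinant step (intermediate result in the proof of Theorem 1): Assume d ≥ 2 and that every matrix S_{i,j} for 1 ≤ i ≤ d and 1 ≤ j ≤ η−d+1 is positive definite. For 1 ≤ j ≤ η−d+1, let N'(η−j) = #X'_SG(η−j) denote the size of the (d−1)-dimensional sparse grid design of level η−j built from the component designs of dimensions 1,…,d−1, let Σ'(η−j) be its covariance matrix, and let S_{d,j} / S_{d,j−1} denote the Schur complement of S_{d,j} with respect to its principal block indexed by X_{d,j−1} ⊆ X_{d,j} (with the convention S_{d,1} / S_{d,0} = S_{d,1}). Then det Σ = ∏_{j=1}^{η−d+1} det( S_{d,j} / S_{d,j−1} )^{N'(η−j)} · det( Σ'(η−j) )^{ #X_{d,j}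 − #X_{d,j−1} }. -/
open Finset Matrix

noncomputable section

/-- The kernel matrix of a one-dimensional kernel `K` on a finite set `B1`. -/
def kmat1 (K : ℝ → ℝ → ℝ) (B1 : Finset ℝ) : Matrix ↥B1 ↥B1 ℝ :=
  Matrix.of fun u v => K u.1 v.1

/-- The Schur complement of the kernel matrix of `K` on `B` with respect to its principal
block indexed by `B1 ⊆ B`; it is indexed by `B \ B1` and has entries
`K(s,t) − K[s,B1]·K[B1,B1]^{-1}·K[B1,t]`.  (When `B1 = ∅` this is just the kernel matrix
on `B`, giving the convention `S_{d,1}/S_{d,0} = S_{d,1}`.) -/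
def schurComp (K : ℝ → ℝ → ℝ) (B1 B : Finset ℝ) : Matrix ↥(B \ B1) ↥(B \ B1) ℝ :=
  Matrix.of fun s t =>
    K s.1 t.1 - ∑ u : ↥B1, ∑ v : ↥B1, K s.1 u.1 * (kmat1 K B1)⁻¹ u v * K v.1 t.1

/-- The matrix of values of a kernel on a finite set. -/
def kernelMatrix {α : Type*} (K : α → α → ℝ) (s : Finset α) : Matrix ↥s ↥s ℝ :=
  Matrix.of fun x y => K x.1 y.1

theorem det_kernelMatrix_map {α β : Type*} [DecidableEq α] [DecidableEq β] (e : α ≃ β)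
    {K : α → α → ℝ} {L : β → β → ℝ} (hKL : ∀ x y, K x y = L (e x) (e y))
    {s : Finset α} {t : Finset β} (hst : ∀ x, x ∈ s ↔ e x ∈ t) :
    (kernelMatrix K s).det = (kernelMatrix L t).det := by
  rw [← Matrix.det_submatrix_equiv_self (e.subtypeEquiv hst) (kernelMatrix L t)]
  congr 1
  ext x y
  exact hKL x y

/-- If the lower rows of the left block column are a combination of the upper ones, the
determinant factors after one step of block elimination. -/
theorem det_fromBlocks_of_mul_eq {m n : Type*} [Fintype m] [Fintype n] [DecidableEq m]
    [DecidableEq n] (A : Matrix m m ℝ) (B : Matrix m n ℝ) (D : Matrix n n ℝ) (W : Matrix n m ℝ) :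
    (Matrix.fromBlocks A B (W * A) D).det = A.det * (D - W * B).det := by
  have h : Matrix.fromBlocks 1 0 (-W) 1 * Matrix.fromBlocks A B (W * A) D =
      Matrix.fromBlocks A B 0 (D - W * B) := by
    rw [Matrix.fromBlocks_multiply]
    simp [sub_eq_neg_add]
  have h' := congrArg Matrix.det h
  rwa [Matrix.det_mul, Matrix.det_fromBlocks_zero₁₂, Matrix.det_fromBlocks_zero₂₁,
    Matrix.det_one, Matrix.det_one, one_mul, one_mul] at h'

/-- The product of a one-dimensional kernel with a kernel on `α`. -/
def prodKernel {α : Type*} (K : ℝ → ℝ → ℝ) (K' : α → α → ℝ) (x y : ℝ × α) : ℝ :=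
  K x.1 y.1 * K' x.2 y.2

theorem sum_mul_kmat1_inv_mul (K : ℝ → ℝ → ℝ) (A : Finset ℝ) (hK : IsUnit (kmat1 K A).det)
    (s : ℝ) (t : ↥A) :
    ∑ u : ↥A, ∑ v : ↥A, K s u * (kmat1 K A)⁻¹ u v * K v t = K s t := by
  have h : ∀ u, ∑ v : ↥A, (kmat1 K A)⁻¹ u v * K v t = (1 : Matrix ↥A ↥A ℝ) u t := fun u => by
    rw [← Matrix.nonsing_inv_mul _ hK]
    rfl
  simp_rw [mul_assoc, ← Finset.mul_sum, h, Matrix.one_apply]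
  simp

/-- The coefficients expressing the rows of a product kernel matrix over new points `H` through
its rows over `G`, by elimination in the first factor along `A`. -/
def elimCoeff {α : Type*} [DecidableEq α] (K : ℝ → ℝ → ℝ) (A : Finset ℝ) (G H : Finset (ℝ × α)) :
    Matrix ↥H ↥G ℝ :=
  Matrix.of fun x y => ∑ u : ↥A, ∑ v : ↥A,
    if (v.1, x.1.2) = y.1 then K x.1.1 u * (kmat1 K A)⁻¹ u v else 0

theorem sum_elimCoeff_mul {α : Type*} [DecidableEq α] (K : ℝ → ℝ → ℝ) (K' : α → α → ℝ)
    (A : Finset ℝ) (G H : Finset (ℝ × α)) (x : ↥H) (hx : ∀ v ∈ A, (v, x.1.2) ∈ G) (z : ℝ × α) :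
    ∑ y : ↥G, elimCoeff K A G H x y * prodKernel K K' y.1 z =
      (∑ u : ↥A, ∑ v : ↥A, K x.1.1 u * (kmat1 K A)⁻¹ u v * K v z.1) * K' x.1.2 z.2 := by
  simp only [elimCoeff, Matrix.of_apply, Finset.sum_mul]
  rw [Finset.sum_comm]
  refine Finset.sum_congr rfl fun u _ => ?_
  rw [Finset.sum_comm]
  refine Finset.sum_congr rfl fun v _ => ?_
  rw [Finset.sum_eq_single ⟨(v.1, x.1.2), hx v v.2⟩]
  · simp [prodKernel, mul_assoc]
  · intro y _ hy
    rw [if_neg fun h => hy (Subtype.ext h.symm), zero_mul]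
  · simp

theorem det_kernelMatrix_prod {α : Type*} [DecidableEq α] (A B : Finset ℝ) (Q : Finset α)
    (S : Matrix ↥(B \ A) ↥(B \ A) ℝ) (K' : α → α → ℝ)
    (M : Matrix ↥((B \ A) ×ˢ Q) ↥((B \ A) ×ˢ Q) ℝ)
    (hM : ∀ x y, M x y =
      S ⟨x.1.1, (Finset.mem_product.1 x.2).1⟩ ⟨y.1.1, (Finset.mem_product.1 y.2).1⟩ *
        K' x.1.2 y.1.2) :
    M.det = S.det ^ Q.card * (kernelMatrix K' Q).det ^ (B \ A).card := by
  let e : ↥((B \ A) ×ˢ Q) ≃ ↥(B \ A) × ↥Q :=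
    { toFun := fun x =>
        (⟨x.1.1, (Finset.mem_product.1 x.2).1⟩, ⟨x.1.2, (Finset.mem_product.1 x.2).2⟩)
      invFun := fun y => ⟨(y.1.1, y.2.1), Finset.mem_product.2 ⟨y.1.2, y.2.2⟩⟩
      left_inv := fun _ => rfl
      right_inv := fun _ => rfl }
  have h : M = (Matrix.kroneckerMap (· * ·) S (kernelMatrix K' Q)).submatrix e e := by
    ext x y
    exact hM x y
  rw [h, Matrix.det_submatrix_equiv_self, Matrix.det_kronecker, Fintype.card_coe, Fintype.card_coe]

/-- Adding the product block `(B \ A) × Q` to a set of points lying over `A` and containing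
`A × Q` multiplies the determinant by that of a Kronecker product. -/
theorem det_prodKernel_union {α : Type*} [DecidableEq α] (K : ℝ → ℝ → ℝ) (K' : α → α → ℝ)
    (A B : Finset ℝ) (Q : Finset α) (G : Finset (ℝ × α)) (hK : IsUnit (kmat1 K A).det)
    (hG : ∀ x ∈ G, x.1 ∈ A) (hQ : A ×ˢ Q ⊆ G) :
    (kernelMatrix (prodKernel K K') (G ∪ (B \ A) ×ˢ Q)).det =
      (kernelMatrix (prodKernel K K') G).det *
        ((schurComp K A B).det ^ Q.card * (kernelMatrix K' Q).det ^ (B \ A).card) := by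
  set H := (B \ A) ×ˢ Q with hH
  have hdisj : Disjoint G H := Finset.disjoint_left.2 fun x hx hx' =>
    (Finset.mem_sdiff.1 (Finset.mem_product.1 hx').1).2 (hG x hx)
  have hmem : ∀ x : ↥H, ∀ v ∈ A, (v, x.1.2) ∈ G := fun x v hv =>
    hQ (Finset.mem_product.2 ⟨hv, (Finset.mem_product.1 x.2).2⟩)
  let L := prodKernel K K'
  let M₁₂ : Matrix ↥G ↥H ℝ := Matrix.of fun x y => L x.1 y.1
  let W := elimCoeff K A G H
  have hblocks : (kernelMatrix L (G ∪ H)).submatrix (Equiv.Finset.union G H hdisj)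
      (Equiv.Finset.union G H hdisj) =
      Matrix.fromBlocks (kernelMatrix L G) M₁₂ (W * kernelMatrix L G) (kernelMatrix L H) := by
    ext (x | x) (y | y)
    · rfl
    · rfl
    · refine Eq.trans ?_ (sum_elimCoeff_mul K K' A G H x (hmem x) y.1).symm
      rw [sum_mul_kmat1_inv_mul K A hK x.1.1 ⟨y.1.1, hG _ y.2⟩]
      rfl
    · rfl
  rw [← Matrix.det_submatrix_equiv_self (Equiv.Finset.union G H hdisj), hblocks,
    det_fromBlocks_of_mul_eq]
  congr 1
  refine det_kernelMatrix_prod A B Q (schurComp K A B) K' _ fun x y => ?_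
  have h := sum_elimCoeff_mul K K' A G H x (hmem x) y.1
  change L x.1 y.1 - ∑ z : ↥G, W x z * L z.1 y.1 = _
  rw [h]
  simp only [schurComp, Matrix.of_apply, L, prodKernel, sub_mul]

/-- The determinant of a product kernel on a union of boxes `A j × P j`, with `A` increasing and
`P` decreasing. -/
theorem det_prodKernel_biUnion {α : Type*} [DecidableEq α] (K : ℝ → ℝ → ℝ) (K' : α → α → ℝ)
    (A : ℕ → Finset ℝ) (P : ℕ → Finset α) (hA0 : A 0 = ∅) (hA : ∀ j, A j ⊆ A (j + 1)) (n : ℕ)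
    (hP : ∀ j, 1 ≤ j → j < n → P (j + 1) ⊆ P j)
    (hK : ∀ j, 1 ≤ j → j < n → IsUnit (kmat1 K (A j)).det) :
    (kernelMatrix (prodKernel K K') ((Finset.Icc 1 n).biUnion fun j => A j ×ˢ P j)).det =
      ∏ j ∈ Finset.Icc 1 n, (schurComp K (A (j - 1)) (A j)).det ^ (P j).card *
        (kernelMatrix K' (P j)).det ^ ((A j).card - (A (j - 1)).card) := by
  induction n with
  | zero =>
    have : IsEmpty ↥((Finset.Icc 1 0).biUnion fun j => A j ×ˢ P j) :=
      Finset.isEmpty_coe_sort.2 (by simp)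
    rw [Matrix.det_isEmpty]
    simp
  | succ n ih =>
    have hmono : Monotone A := monotone_nat_of_le_succ hA
    have hKn : IsUnit (kmat1 K (A n)).det := by
      rcases Nat.eq_zero_or_pos n with rfl | hn
      · have : IsEmpty ↥(A 0) := Finset.isEmpty_coe_sort.2 hA0
        simp [Matrix.det_isEmpty]
      · exact hK n hn n.lt_succ_self
    have hsub : A n ×ˢ P (n + 1) ⊆ (Finset.Icc 1 n).biUnion fun j => A j ×ˢ P j := by
      rcases Nat.eq_zero_or_pos n with rfl | hn
      · simp [hA0]
      · exact (Finset.product_subset_product_right (hP n hn n.lt_succ_self)).trans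
          (Finset.subset_biUnion_of_mem (fun j => A j ×ˢ P j) (Finset.mem_Icc.2 ⟨hn, le_rfl⟩))
    have hunion : ((Finset.Icc 1 (n + 1)).biUnion fun j => A j ×ˢ P j) =
        ((Finset.Icc 1 n).biUnion fun j => A j ×ˢ P j) ∪ (A (n + 1) \ A n) ×ˢ P (n + 1) := by
      rw [← Finset.insert_Icc_right_eq_Icc_add_one (by omega), Finset.biUnion_insert,
        Finset.union_comm]
      refine Finset.Subset.antisymm (fun x hx => ?_)
        (Finset.union_subset_union_right (Finset.product_subset_product_left Finset.sdiff_subset))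
      rcases Finset.mem_union.1 hx with h | h
      · exact Finset.mem_union_left _ h
      · obtain ⟨h1, h2⟩ := Finset.mem_product.1 h
        by_cases hx1 : x.1 ∈ A n
        · exact Finset.mem_union_left _ (hsub (Finset.mem_product.2 ⟨hx1, h2⟩))
        · exact Finset.mem_union_right _
            (Finset.mem_product.2 ⟨Finset.mem_sdiff.2 ⟨h1, hx1⟩, h2⟩)
    have hfst : ∀ x ∈ (Finset.Icc 1 n).biUnion fun j => A j ×ˢ P j, x.1 ∈ A n := by
      intro x hx
      obtain ⟨j, hj, hxj⟩ := Finset.mem_biUnion.1 hx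
      exact hmono (Finset.mem_Icc.1 hj).2 (Finset.mem_product.1 hxj).1
    rw [hunion, det_prodKernel_union K K' (A n) (A (n + 1)) (P (n + 1)) _ hKn hfst hsub,
      ih (fun j h1 h2 => hP j h1 (by omega)) (fun j h1 h2 => hK j h1 (by omega)),
      Finset.prod_Icc_succ_top (by omega), Nat.add_sub_cancel,
      Finset.card_sdiff_of_subset (hA n)]

theorem mem_sparseGrid {d : ℕ} {X : Fin d → ℕ → Finset ℝ} {η : ℕ} {x : Fin d → ℝ} :
    x ∈ sparseGrid X η ↔
      ∃ j : Fin d → ℕ, (∀ i, 1 ≤ j i) ∧ ∑ i, j i = η ∧ ∀ i, x i ∈ X i (j i) := by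
  simp only [sparseGrid, lattice, idxE, Finset.mem_biUnion, Finset.mem_filter,
    Fintype.mem_piFinset, Finset.mem_Icc]
  constructor
  · rintro ⟨j, ⟨h1, h2⟩, h3⟩
    exact ⟨j, fun i => (h1 i).1, h2, h3⟩
  · rintro ⟨j, h1, h2, h3⟩
    exact ⟨j, ⟨fun i => ⟨h1 i, h2 ▸ Finset.single_le_sum (fun _ _ => Nat.zero_le _)
      (Finset.mem_univ i)⟩, h2⟩, h3⟩

theorem sparseGrid_subset_succ {d : ℕ} (hd : 1 ≤ d) {X : Fin d → ℕ → Finset ℝ}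
    (hX : ∀ i j, X i j ⊆ X i (j + 1)) (η : ℕ) : sparseGrid X η ⊆ sparseGrid X (η + 1) := by
  intro x hx
  obtain ⟨j, h1, h2, h3⟩ := mem_sparseGrid.1 hx
  let i₀ : Fin d := ⟨0, hd⟩
  refine mem_sparseGrid.2 ⟨j + Pi.single i₀ 1, fun i => (h1 i).trans (Nat.le_add_right _ _), ?_,
    fun i => ?_⟩
  · simp [Finset.sum_add_distrib, h2]
  · exact monotone_nat_of_le_succ (hX i) (Nat.le_add_right _ _) (h3 i)

theorem mem_sparseGrid_succ {m : ℕ} {X : Fin (m + 1) → ℕ → Finset ℝ} {η : ℕ}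
    {x : Fin (m + 1) → ℝ} :
    x ∈ sparseGrid X η ↔ (x (Fin.last m), Fin.init x) ∈ (Finset.Icc 1 (η - m)).biUnion fun j =>
      X (Fin.last m) j ×ˢ sparseGrid (fun i : Fin m => X i.castSucc) (η - j) := by
  simp only [Finset.mem_biUnion, Finset.mem_product, Finset.mem_Icc, mem_sparseGrid]
  constructor
  · rintro ⟨j, h1, h2, h3⟩
    rw [Fin.sum_univ_castSucc] at h2
    have hm : m ≤ ∑ i : Fin m, j i.castSucc := by
      simpa using Finset.card_nsmul_le_sum Finset.univ (fun i : Fin m => j i.castSucc) 1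
        fun i _ => h1 _
    exact ⟨j (Fin.last m), ⟨h1 _, by omega⟩, h3 _, fun i => j i.castSucc, fun i => h1 _,
      Nat.eq_sub_of_add_eq h2, fun i => h3 _⟩
  · rintro ⟨k, ⟨hk1, hk2⟩, hk3, j, h1, h2, h3⟩
    refine ⟨Fin.snoc j k, fun i => ?_, ?_, fun i => ?_⟩
    · refine Fin.lastCases ?_ (fun i => ?_) i
      · simpa using hk1
      · simpa using h1 i
    · rw [Fin.sum_univ_castSucc]
      simp only [Fin.snoc_castSucc, Fin.snoc_last, h2]
      omega
    · refine Fin.lastCases ?_ (fun i => ?_) i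
      · simpa using hk3
      · simpa [Fin.init] using h3 i

/-- **Inductive determinant step** (intermediate result in the proof of Theorem 1):
`det Σ = ∏_{j=1}^{η−d+1} det(S_{d,j}/S_{d,j−1})^{N'(η−j)} · det(Σ'(η−j))^{#X_{d,j}−#X_{d,j−1}}`,
where `N'(η−j)` and `Σ'(η−j)` are the size and the covariance matrix of the
`(d−1)`-dimensional sparse grid design of level `η−j` built from the component designs of
dimensions `1,…,d−1`. -/
theorem det_sparse_grid_inductive_step (d η : ℕ) (hd : 2 ≤ d) (hη : d ≤ η)
    (X : Fin d → ℕ → Finset ℝ) (hX0 : ∀ i, X i 0 = ∅)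
    (hnest : ∀ i j, X i j ⊆ X i (j + 1))
    (C : Fin d → ℝ → ℝ → ℝ)
    (hS : ∀ (i : Fin d) (j : ℕ), 1 ≤ j → j ≤ η - d + 1 → (Smat X C i j).PosDef) :
    (SigmaMat X C η).det =
      ∏ j ∈ Finset.Icc 1 (η - d + 1),
        (schurComp (C ⟨d - 1, by omega⟩)
              (X ⟨d - 1, by omega⟩ (j - 1)) (X ⟨d - 1, by omega⟩ j)).det ^
            (sparseGrid (fun i : Fin (d - 1) => X (Fin.castLE (Nat.sub_le d 1) i))
              (η - j)).card *
          (SigmaMat (fun i : Fin (d - 1) => X (Fin.castLE (Nat.sub_le d 1) i))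
                (fun i : Fin (d - 1) => C (Fin.castLE (Nat.sub_le d 1) i)) (η - j)).det ^
            ((X ⟨d - 1, by omega⟩ j).card - (X ⟨d - 1, by omega⟩ (j - 1)).card) := by
  obtain ⟨m, rfl⟩ : ∃ m, d = m + 1 := ⟨d - 1, by omega⟩
  rw [show η - (m + 1) + 1 = η - m by omega] at hS ⊢
  let K' : (Fin m → ℝ) → (Fin m → ℝ) → ℝ := fun p q => ∏ i, C i.castSucc (p i) (q i)
  refine Eq.trans ?_ (det_prodKernel_biUnion (C (Fin.last m)) K' (X (Fin.last m))
    (fun j => sparseGrid (fun i : Fin m => X i.castSucc) (η - j)) (hX0 _) (hnest _) (η - m) ?_ ?_)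
  · refine det_kernelMatrix_map (K := fun x y => ∏ i, C i (x i) (y i))
      (Fin.snocEquiv fun _ => ℝ).symm (fun x y => ?_) fun x => mem_sparseGrid_succ
    rw [Fin.prod_univ_castSucc, mul_comm]
    rfl
  · intro j _ hj
    have h := sparseGrid_subset_succ (by omega) (fun i : Fin m => hnest i.castSucc) (η - (j + 1))
    rwa [show η - (j + 1) + 1 = η - j by omega] at h
  · intro j h1 hj
    exact (hS (Fin.last m) j h1 hj.le).det_pos.ne'.isUnit
end
end
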